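/- Let n be a negative integer and let Q = [a,b,c] be an integral binary quadratic form of discriminant 4n and content k, so that d' := 4n/k² is the discriminant of the primitive form Q/k. Then, as T → ∞, D_T^Q = 6T/(ω(d')·π·|n|^{1/2}) + o(T). -/

import Mathlib

open Filter Real Asymptotics

/-- The substitution action of `SL₂(ℤ)` on integral binary quadratic forms, where a form
`a x² + b x y + c y²` is encoded as the triple `(a, b, c)`: for `g = (p q; r s)` the form
`g • Q` is `(x, y) ↦ Q (p x + q y, r x + s y)`. -/
def actForm (g : Matrix.SpecialLinearGroup (Fin 2) ℤ) (Q : ℤ × ℤ × ℤ) : ℤ × ℤ × ℤ :=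
  let p := (g : Matrix (Fin 2) (Fin 2) ℤ) 0 0
  let q := (g : Matrix (Fin 2) (Fin 2) ℤ) 0 1
  let r := (g : Matrix (Fin 2) (Fin 2) ℤ) 1 0
  let s := (g : Matrix (Fin 2) (Fin 2) ℤ) 1 1
  (Q.1 * p ^ 2 + Q.2.1 * p * r + Q.2.2 * r ^ 2,
   2 * Q.1 * p * q + Q.2.1 * (p * s + q * r) + 2 * Q.2.2 * r * s,
   Q.1 * q ^ 2 + Q.2.1 * q * s + Q.2.2 * s ^ 2)

/-- Proper (`SL₂(ℤ)`) equivalence of integral binary quadratic forms. -/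
def ProperEquiv (Q Q' : ℤ × ℤ × ℤ) : Prop := ∃ g, actForm g Q = Q'

/-- `DTQ n Q T` is the number of `D(n)`-pairs `{a, c}` (written with `a > c`) with
`a, c ∈ {-T, …, T}` whose associated form `E_{ac} = [a, 2√(ac+n), c]` is properly
equivalent to `Q`. -/
noncomputable def DTQ (n : ℤ) (Q : ℤ × ℤ × ℤ) (T : ℝ) : ℕ :=
  Set.ncard {ac : ℤ × ℤ | ac.2 < ac.1 ∧ ac.1 ≠ 0 ∧ ac.2 ≠ 0 ∧
    |(ac.1 : ℝ)| ≤ T ∧ |(ac.2 : ℝ)| ≤ T ∧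
    ∃ b : ℤ, 0 ≤ b ∧ b ^ 2 = ac.1 * ac.2 + n ∧ ProperEquiv (ac.1, 2 * b, ac.2) Q}

/-- `FTQ Q T` is the number of integral binary quadratic forms `[a, b, c]` with
`|a| ≤ T`, `|c| ≤ T`, `a > c`, `b ≥ 0` which are properly equivalent to `Q`. -/
noncomputable def FTQ (Q : ℤ × ℤ × ℤ) (T : ℝ) : ℕ :=
  Set.ncard {f : ℤ × ℤ × ℤ | |(f.1 : ℝ)| ≤ T ∧ |(f.2.2 : ℝ)| ≤ T ∧
    f.2.2 < f.1 ∧ 0 ≤ f.2.1 ∧ ProperEquiv f Q}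

/-- `ω(d)`: the number of `SL₂(ℤ)`-automorphs of a primitive definite form of
discriminant `d`. -/
def omegaDisc (d : ℤ) : ℕ := if d = -4 then 4 else if d = -3 then 6 else 2

/-- The value `a x² + b x y + c y²` of the form `Q = (a, b, c)` at `v = (x, y)`. -/
def formVal (Q : ℤ × ℤ × ℤ) (v : ℤ × ℤ) : ℤ :=
  Q.1 * v.1 ^ 2 + Q.2.1 * v.1 * v.2 + Q.2.2 * v.2 ^ 2

lemma volume_unit_disc :
    MeasureTheory.volume {u : Fin 2 → ℝ | u 0 ^ 2 + u 1 ^ 2 ≤ 1} = ENNReal.ofReal π := by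
  have h := (PiLp.volume_preserving_toLp (Fin 2)).measure_preimage
    (s := Metric.closedBall (0 : EuclideanSpace ℝ (Fin 2)) 1)
    Metric.isClosed_closedBall.measurableSet.nullMeasurableSet
  rw [EuclideanSpace.volume_closedBall_fin_two] at h
  convert h using 1
  · congr 1
    ext u
    simp [EuclideanSpace.norm_eq, Fin.sum_univ_two]
  · simp

lemma convex_unit_disc : Convex ℝ {u : Fin 2 → ℝ | u 0 ^ 2 + u 1 ^ 2 ≤ 1} := by
  intro u hu v hv s t hs ht hst
  simp only [Set.mem_ofPred_eq, Pi.add_apply, Pi.smul_apply, smul_eq_mul] at *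
  obtain rfl : t = 1 - s := by linarith
  nlinarith [mul_nonneg hs ht, mul_nonneg (mul_nonneg hs ht) (sq_nonneg (u 0 - v 0)),
    mul_nonneg (mul_nonneg hs ht) (sq_nonneg (u 1 - v 1))]

lemma covolume_span_basisFun :
    ZLattice.covolume (Submodule.span ℤ (Set.range (Pi.basisFun ℝ (Fin 2)))) = 1 := by
  rw [ZLattice.covolume_eq_measure_fundamentalDomain _ _
    (ZSpan.isAddFundamentalDomain (Pi.basisFun ℝ (Fin 2)) _), MeasureTheory.measureReal_def,
    ZSpan.fundamentalDomain_pi_basisFun, Real.volume_pi_Ico]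
  simp

/-- Lattice points in a dilated ellipse: the number of integral vectors with
`a x² + b x y + c y² ≤ T` is asymptotic to the area of the ellipse. -/
lemma tendsto_card_formVal_le {n a b c : ℤ} (hn : n < 0) (ha : 0 < a)
    (hD : b ^ 2 - 4 * a * c = 4 * n) :
    Tendsto (fun T : ℝ => ({v : ℤ × ℤ | (formVal (a, b, c) v : ℝ) ≤ T}.ncard : ℝ) / T) atTop
      (nhds (π / √|(n : ℝ)|)) := by
  have hn' : (n : ℝ) < 0 := by exact_mod_cast hn
  have ha' : (0 : ℝ) < a := by exact_mod_cast ha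
  have hD' : (b : ℝ) ^ 2 - 4 * a * c = 4 * n := by exact_mod_cast hD
  have hab : |(n : ℝ)| = -n := abs_of_neg hn'
  set F : (Fin 2 → ℝ) → ℝ := fun u => a * u 0 ^ 2 + b * u 0 * u 1 + c * u 1 ^ 2 with hF
  set A : Matrix (Fin 2) (Fin 2) ℝ := !![√a, b / (2 * √a); 0, √(-n) / √a] with hA
  have hsa : √(a : ℝ) ^ 2 = a := Real.sq_sqrt ha'.le
  have hsa0 : 0 < √(a : ℝ) := Real.sqrt_pos.2 ha'
  have hsn : √(-n : ℝ) ^ 2 = -n := Real.sq_sqrt (by linarith)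
  have hsn0 : 0 < √(-n : ℝ) := Real.sqrt_pos.2 (by linarith)
  have hdet : LinearMap.det (Matrix.toLin' A) = √(-n : ℝ) := by
    rw [LinearMap.det_toLin', hA, Matrix.det_fin_two_of]
    field_simp
    ring
  have hpre : {x | x ∈ Set.univ ∧ F x ≤ 1} =
      Matrix.toLin' A ⁻¹' {u : Fin 2 → ℝ | u 0 ^ 2 + u 1 ^ 2 ≤ 1} := by
    ext u
    have : (√a * u 0 + b / (2 * √a) * u 1) ^ 2 + (√(-n : ℝ) / √a * u 1) ^ 2 = F u := by
      have h1 : (√a * u 0 + b / (2 * √a) * u 1) ^ 2 + (√(-n : ℝ) / √a * u 1) ^ 2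
        = √a ^ 2 * u 0 ^ 2 + b * u 0 * u 1 + b ^ 2 / (4 * √a ^ 2) * u 1 ^ 2
          + √(-n : ℝ) ^ 2 / √a ^ 2 * u 1 ^ 2 := by
        field_simp
        ring
      rw [h1, hsa, hsn, hF]
      field_simp
      linear_combination u 1 ^ 2 * hD'
    simp [hA, Matrix.toLin'_apply, Matrix.mulVec, dotProduct, Fin.sum_univ_two, ← this]
  have hcont : Continuous F := by fun_prop
  have hconv : Convex ℝ {x | x ∈ Set.univ ∧ F x ≤ 1} := by
    rw [hpre]; exact convex_unit_disc.linear_preimage _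
  have key := ZLattice.covolume.tendsto_card_le_div
    (Submodule.span ℤ (Set.range (Pi.basisFun ℝ (Fin 2)))) (X := Set.univ) (F := F)
    (fun _ _ _ _ => Set.mem_univ _) ?_ ?_ ?_ (hconv.addHaar_frontier _)
  · rw [covolume_span_basisFun, div_one, MeasureTheory.measureReal_def, hpre,
      MeasureTheory.Measure.addHaar_preimage_linearMap _ (by rw [hdet]; exact hsn0.ne'),
      volume_unit_disc, hdet, ENNReal.toReal_mul, ENNReal.toReal_ofReal (abs_nonneg _),
      ENNReal.toReal_ofReal pi_pos.le, abs_of_pos (by positivity), ← hab, inv_mul_eq_div] at key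
    refine key.congr fun T => ?_
    congr 2
    rw [Nat.card_coe_set_eq]
    symm
    refine Set.ncard_congr (fun v _ => ![(v.1 : ℝ), (v.2 : ℝ)]) ?_ ?_ ?_
    · intro v hv
      refine ⟨⟨Set.mem_univ _, ?_⟩, ?_⟩
      · simpa [hF, formVal] using hv
      · rw [SetLike.mem_coe, Module.Basis.mem_span_iff_repr_mem]
        intro i
        fin_cases i <;> simp
    · rintro ⟨x, y⟩ ⟨x', y'⟩ _ _ h
      have h0 := congrFun h 0
      have h1 := congrFun h 1
      simp at h0 h1
      simp [h0, h1]
    · rintro u ⟨⟨-, hu⟩, hL⟩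
      rw [SetLike.mem_coe, Module.Basis.mem_span_iff_repr_mem] at hL
      obtain ⟨x, hx⟩ := hL 0
      obtain ⟨y, hy⟩ := hL 1
      simp at hx hy
      refine ⟨(x, y), ?_, ?_⟩
      · simpa [formVal, hx, hy] using hu
      · ext i
        fin_cases i <;> simp [hx, hy]
  · intro x r _
    simp [hF]
    ring
  · refine (Metric.isBounded_Icc (fun _ : Fin 2 => -(1 + a + c : ℝ))
      (fun _ : Fin 2 => (1 + a + c : ℝ))).subset ?_
    rintro u ⟨-, hu⟩
    have hn1 : (n : ℝ) ≤ -1 := by exact_mod_cast (by omega : n ≤ -1)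
    have hc : (0 : ℝ) < c := by nlinarith
    have h0 : u 0 ^ 2 ≤ c := by
      have : F u * (4 * c) = (b * u 0 + 2 * c * u 1) ^ 2 + 4 * (-n) * u 0 ^ 2 := by
        simp only [hF]; linear_combination (-u 0 ^ 2) * hD'
      nlinarith [sq_nonneg (b * u 0 + 2 * c * u 1), sq_nonneg (u 0)]
    have h1 : u 1 ^ 2 ≤ a := by
      have : F u * (4 * a) = (2 * a * u 0 + b * u 1) ^ 2 + 4 * (-n) * u 1 ^ 2 := by
        simp only [hF]; linear_combination (-u 1 ^ 2) * hD'
      nlinarith [sq_nonneg (2 * a * u 0 + b * u 1), sq_nonneg (u 1)]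
    have h0' := abs_le_of_sq_le_sq' (a := u 0) (b := 1 + a + c) (by nlinarith) (by positivity)
    have h1' := abs_le_of_sq_le_sq' (a := u 1) (b := 1 + a + c) (by nlinarith) (by positivity)
    refine ⟨fun i => ?_, fun i => ?_⟩ <;> fin_cases i <;> simp <;> linarith
  · simp only [Set.mem_univ, true_and]
    exact (isClosed_le hcont continuous_const).measurableSet

section PositiveDefinite

variable {n a b c : ℤ}

lemma sq_snd_le_formVal (hn : n < 0) (hD : b ^ 2 - 4 * a * c = 4 * n) (v : ℤ × ℤ) :
    v.2 ^ 2 ≤ a * formVal (a, b, c) v := by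
  have h : 4 * (a * formVal (a, b, c) v) = (2 * a * v.1 + b * v.2) ^ 2 + 4 * (-n) * v.2 ^ 2 := by
    simp only [formVal]; linear_combination (-v.2 ^ 2) * hD
  nlinarith [sq_nonneg (2 * a * v.1 + b * v.2), sq_nonneg v.2]

lemma pos_of_disc (hn : n < 0) (ha : 0 < a) (hD : b ^ 2 - 4 * a * c = 4 * n) : 0 < c := by
  by_contra! h
  nlinarith [sq_nonneg b, mul_nonneg ha.le (neg_nonneg.2 h)]

lemma sq_fst_le_formVal (hn : n < 0) (hD : b ^ 2 - 4 * a * c = 4 * n) (v : ℤ × ℤ) :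
    v.1 ^ 2 ≤ c * formVal (a, b, c) v := by
  have := sq_snd_le_formVal (a := c) (b := b) (c := a) hn (by linarith) (v.2, v.1)
  simp only [formVal] at *
  linarith

lemma formVal_pos (hn : n < 0) (ha : 0 < a) (hD : b ^ 2 - 4 * a * c = 4 * n) {v : ℤ × ℤ}
    (hv : v ≠ 0) : 0 < formVal (a, b, c) v := by
  have h1 := sq_fst_le_formVal hn hD v
  have h2 := sq_snd_le_formVal hn hD v
  have hc := pos_of_disc hn ha hD
  by_contra! h
  refine hv (Prod.ext ?_ ?_)
  · exact pow_eq_zero_iff two_ne_zero |>.1 (by nlinarith [sq_nonneg v.1] : v.1 ^ 2 = 0)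
  · exact pow_eq_zero_iff two_ne_zero |>.1 (by nlinarith [sq_nonneg v.2] : v.2 ^ 2 = 0)

lemma finite_formVal_le (hn : n < 0) (ha : 0 < a) (hD : b ^ 2 - 4 * a * c = 4 * n) (T : ℝ) :
    {v : ℤ × ℤ | (formVal (a, b, c) v : ℝ) ≤ T}.Finite := by
  have hc := pos_of_disc hn ha hD
  refine ((Set.finite_Icc (-(c * |⌊T⌋|)) (c * |⌊T⌋|)).prod
    (Set.finite_Icc (-(a * |⌊T⌋|)) (a * |⌊T⌋|))).subset fun v hv => ?_
  have hv' : formVal (a, b, c) v ≤ |⌊T⌋| := (Int.le_floor.2 hv).trans (le_abs_self _)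
  have h1 := sq_fst_le_formVal hn hD v
  have h2 := sq_snd_le_formVal hn hD v
  have h3 := Int.le_self_sq v.1
  have h4 := Int.le_self_sq v.2
  have h5 := Int.le_self_sq (-v.1)
  have h6 := Int.le_self_sq (-v.2)
  have h7 := mul_le_mul_of_nonneg_left hv' hc.le
  have h8 := mul_le_mul_of_nonneg_left hv' ha.le
  simp only [Set.mem_prod, Set.mem_Icc]
  refine ⟨⟨?_, ?_⟩, ?_, ?_⟩ <;> linarith

/-- The number of nonzero integral vectors on which `Q` takes a value at most `T`. -/
noncomputable def nonzeroCount (Q : ℤ × ℤ × ℤ) (T : ℝ) : ℕ :=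
  {v : ℤ × ℤ | v ≠ 0 ∧ (formVal Q v : ℝ) ≤ T}.ncard

/-- The number of primitive integral vectors on which `Q` takes a value at most `T`. -/
noncomputable def primitiveCount (Q : ℤ × ℤ × ℤ) (T : ℝ) : ℕ :=
  {v : ℤ × ℤ | v.1.gcd v.2 = 1 ∧ (formVal Q v : ℝ) ≤ T}.ncard

lemma tendsto_nonzeroCount (hn : n < 0) (ha : 0 < a) (hD : b ^ 2 - 4 * a * c = 4 * n) :
    Tendsto (fun T : ℝ => (nonzeroCount (a, b, c) T : ℝ) / T) atTop (nhds (π / √|(n : ℝ)|)) := by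
  have h := (tendsto_card_formVal_le hn ha hD).sub tendsto_inv_atTop_zero
  rw [sub_zero] at h
  refine h.congr' ?_
  filter_upwards [eventually_ge_atTop 0] with T hT
  have h1 : {v : ℤ × ℤ | (formVal (a, b, c) v : ℝ) ≤ T} =
      insert 0 {v : ℤ × ℤ | v ≠ 0 ∧ (formVal (a, b, c) v : ℝ) ≤ T} := by
    ext v
    by_cases hv : v = 0
    · simp [hv, formVal, hT]
    · simp [hv]
  rw [h1, Set.ncard_insert_of_notMem (by simp)
    ((finite_formVal_le hn ha hD T).subset fun v hv => hv.2), nonzeroCount]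
  push_cast
  ring

lemma exists_nonzeroCount_le (hn : n < 0) (ha : 0 < a) (hD : b ^ 2 - 4 * a * c = 4 * n) :
    ∃ C : ℝ, ∀ T : ℝ, 0 ≤ T → (nonzeroCount (a, b, c) T : ℝ) ≤ C * T := by
  obtain ⟨T₀, hT₀⟩ := eventually_atTop.1 ((tendsto_nonzeroCount hn ha hD).eventually
    (eventually_le_nhds (lt_add_one _)))
  set K := π / √|(n : ℝ)| + 1
  refine ⟨max K (nonzeroCount (a, b, c) (max T₀ 1)), fun T hT => ?_⟩
  rcases lt_or_ge T 1 with h1 | h1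
  · have : nonzeroCount (a, b, c) T = 0 := by
      rw [nonzeroCount, Set.ncard_eq_zero
        ((finite_formVal_le hn ha hD T).subset fun v hv => hv.2)]
      refine Set.eq_empty_of_forall_notMem fun v hv => ?_
      have h2 : (1 : ℝ) ≤ formVal (a, b, c) v := by exact_mod_cast formVal_pos hn ha hD hv.1
      linarith [hv.2]
    rw [this, Nat.cast_zero]
    positivity
  rcases le_or_gt (max T₀ 1) T with h2 | h2
  · have := hT₀ T ((le_max_left _ _).trans h2)
    rw [div_le_iff₀ (by linarith)] at this
    exact this.trans (mul_le_mul_of_nonneg_right (le_max_left _ _) hT)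
  · have : nonzeroCount (a, b, c) T ≤ nonzeroCount (a, b, c) (max T₀ 1) :=
      Set.ncard_le_ncard (fun v hv => ⟨hv.1, hv.2.trans h2.le⟩)
        ((finite_formVal_le hn ha hD _).subset fun v hv => hv.2)
    calc (nonzeroCount (a, b, c) T : ℝ) ≤ nonzeroCount (a, b, c) (max T₀ 1) * 1 := by
          rw [mul_one]; exact_mod_cast this
      _ ≤ _ := mul_le_mul (le_max_right _ _) h1 zero_le_one (by positivity)

open ArithmeticFunction in
lemma sum_moebius_divisors {m : ℕ} :
    ∑ d ∈ m.divisors, (moebius d : ℝ) = if m = 1 then 1 else 0 := by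
  have h := congrArg (fun f : ArithmeticFunction ℤ => (f m : ℝ)) moebius_mul_coe_zeta
  simp only [coe_mul_zeta_apply, one_apply] at h
  exact_mod_cast h

open ArithmeticFunction in
/-- Möbius inversion: counting primitive vectors in terms of nonzero ones. -/
lemma primitiveCount_eq_tsum (hn : n < 0) (ha : 0 < a) (hD : b ^ 2 - 4 * a * c = 4 * n) (T : ℝ) :
    (primitiveCount (a, b, c) T : ℝ) =
      ∑' d : ℕ, (moebius d : ℝ) * nonzeroCount (a, b, c) (T / d ^ 2) := by
  classical
  have hfin : {v : ℤ × ℤ | v ≠ 0 ∧ (formVal (a, b, c) v : ℝ) ≤ T}.Finite :=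
    (finite_formVal_le hn ha hD T).subset fun v hv => hv.2
  set S := hfin.toFinset with hS
  have hmem : ∀ v, v ∈ S ↔ v ≠ 0 ∧ (formVal (a, b, c) v : ℝ) ≤ T := fun v => by simp [hS]
  have hg : ∀ v ∈ S, v.1.gcd v.2 ≠ 0 := fun v hv h => by
    rw [Int.gcd_eq_zero_iff] at h
    exact ((hmem v).1 hv).1 (Prod.ext h.1 h.2)
  have hcount : ∀ d : ℕ, d ≠ 0 →
      nonzeroCount (a, b, c) (T / d ^ 2) = (S.filter fun v => d ∣ v.1.gcd v.2).card := by
    intro d hd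
    have hd' : (0 : ℝ) < (d : ℝ) ^ 2 := by positivity
    have hval : ∀ v : ℤ × ℤ, formVal (a, b, c) (d * v.1, d * v.2)
        = formVal (a, b, c) v * d ^ 2 := fun v => by simp only [formVal]; ring
    rw [nonzeroCount, ← Set.ncard_coe_finset]
    refine Set.ncard_congr (fun v _ => (d * v.1, d * v.2)) ?_ ?_ ?_
    · rintro v ⟨hv, hv'⟩
      simp only [Finset.coe_filter, hmem, Set.mem_ofPred_eq]
      refine ⟨⟨fun h => hv ?_, ?_⟩, ?_⟩
      · simp only [Prod.mk_eq_zero, mul_eq_zero, Nat.cast_eq_zero, hd, false_or] at h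
        exact Prod.ext h.1 h.2
      · rw [hval]
        push_cast
        exact (le_div_iff₀ hd').1 hv'
      · rw [Int.gcd_mul_left]
        exact Dvd.intro _ rfl
    · rintro v w - - h
      simp only [Prod.mk.injEq, mul_eq_mul_left_iff, Nat.cast_eq_zero, hd, or_false] at h
      exact Prod.ext h.1 h.2
    · rintro v hv
      simp only [Finset.coe_filter, hmem, Set.mem_ofPred_eq] at hv
      obtain ⟨⟨hv0, hvT⟩, hdv⟩ := hv
      obtain ⟨x, hx⟩ := (Int.natCast_dvd_natCast.2 hdv).trans (Int.gcd_dvd_left v.1 v.2)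
      obtain ⟨y, hy⟩ := (Int.natCast_dvd_natCast.2 hdv).trans (Int.gcd_dvd_right v.1 v.2)
      have hvv : v = (d * x, d * y) := Prod.ext hx hy
      refine ⟨(x, y), ⟨fun h => hv0 ?_, ?_⟩, hvv.symm⟩
      · simp only [Prod.mk_eq_zero] at h
        simp [hvv, h]
      · have h2 := hval (x, y)
        simp only at h2
        rw [hvv, h2] at hvT
        push_cast at hvT
        exact (le_div_iff₀ hd').2 hvT
  set M := ∑ v ∈ S, v.1.gcd v.2 + 1 with hM
  have hlt : ∀ v ∈ S, v.1.gcd v.2 < M := fun v hv =>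
    Nat.lt_succ_of_le (Finset.single_le_sum (f := fun v : ℤ × ℤ => v.1.gcd v.2)
      (fun _ _ => Nat.zero_le _) hv)
  rw [tsum_eq_sum (s := Finset.range M)]
  · have h1 : (primitiveCount (a, b, c) T : ℝ)
        = ∑ v ∈ S, if v.1.gcd v.2 = 1 then (1 : ℝ) else 0 := by
      rw [Finset.sum_boole, primitiveCount, ← Set.ncard_coe_finset]
      congr 2
      ext v
      simp only [Finset.coe_filter, hmem, Set.mem_ofPred_eq]
      refine ⟨fun h => ⟨⟨?_, h.2⟩, h.1⟩, fun h => ⟨h.2, h.1.2⟩⟩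
      rintro rfl
      simp at h
    have h2 : ∀ v ∈ S, (if v.1.gcd v.2 = 1 then (1 : ℝ) else 0)
        = ∑ d ∈ Finset.range M, if d ∣ v.1.gcd v.2 then (moebius d : ℝ) else 0 := by
      intro v hv
      rw [← sum_moebius_divisors, ← Finset.sum_filter]
      congr 1
      ext d
      simp only [Nat.mem_divisors, Finset.mem_filter, Finset.mem_range]
      exact ⟨fun h => ⟨(Nat.le_of_dvd (Nat.pos_of_ne_zero h.2) h.1).trans_lt (hlt v hv), h.1⟩,
        fun h => ⟨h.2, hg v hv⟩⟩
    rw [h1, Finset.sum_congr rfl h2, Finset.sum_comm]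
    refine Finset.sum_congr rfl fun d _ => ?_
    rcases eq_or_ne d 0 with rfl | hd
    · simp
    · rw [hcount d hd, ← Finset.sum_filter, Finset.sum_const, nsmul_eq_mul, mul_comm]
  · intro d hd
    have hd0 : d ≠ 0 := by rintro rfl; simp [hM] at hd
    rw [hcount d hd0, Finset.card_eq_zero.2, Nat.cast_zero, mul_zero]
    refine Finset.filter_eq_empty_iff.2 fun v hv h => hd (Finset.mem_range.2 ?_)
    exact (Nat.le_of_dvd (Nat.pos_of_ne_zero (hg v hv)) h).trans_lt (hlt v hv)

open ArithmeticFunction in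
lemma tsum_moebius_div_sq : ∑' d : ℕ, (moebius d : ℝ) / d ^ 2 = 6 / π ^ 2 := by
  have h := LSeries_zeta_mul_Lseries_moebius (s := 2) (by norm_num)
  rw [LSeries_zeta_eq_riemannZeta (by norm_num), riemannZeta_two] at h
  have h2 : LSeries (fun d => ((moebius d : ℤ) : ℂ)) 2
      = ((∑' d : ℕ, (moebius d : ℝ) / d ^ 2 : ℝ) : ℂ) := by
    rw [LSeries, Complex.ofReal_tsum]
    refine tsum_congr fun d => ?_
    rcases eq_or_ne d 0 with rfl | hd
    · simp
    · rw [LSeries.term_of_ne_zero hd]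
      push_cast
      norm_cast
  rw [h2] at h
  have h3 : π ^ 2 / 6 * ∑' d : ℕ, (moebius d : ℝ) / d ^ 2 = 1 := by exact_mod_cast h
  have := pi_ne_zero
  field_simp at h3 ⊢
  linarith

open ArithmeticFunction in
/-- The number of primitive vectors with `Q ≤ T` is asymptotic to `6 T / (π √|n|)`. -/
lemma tendsto_primitiveCount (hn : n < 0) (ha : 0 < a) (hD : b ^ 2 - 4 * a * c = 4 * n) :
    Tendsto (fun T : ℝ => (primitiveCount (a, b, c) T : ℝ) / T) atTop
      (nhds (6 / (π * √|(n : ℝ)|))) := by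
  obtain ⟨C, hC⟩ := exists_nonzeroCount_le hn ha hD
  have hlim : 6 / (π * √|(n : ℝ)|)
      = ∑' d : ℕ, (moebius d : ℝ) / d ^ 2 * (π / √|(n : ℝ)|) := by
    rw [tsum_mul_right, tsum_moebius_div_sq]
    have := pi_ne_zero
    field_simp
  rw [hlim]
  have key : Tendsto (fun T : ℝ => ∑' d : ℕ, (moebius d : ℝ) *
      nonzeroCount (a, b, c) (T / d ^ 2) / T) atTop
      (nhds (∑' d : ℕ, (moebius d : ℝ) / d ^ 2 * (π / √|(n : ℝ)|))) := by
    refine tendsto_tsum_of_dominated_convergence (bound := fun d : ℕ => C * (1 / (d : ℝ) ^ 2))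
      ((Real.summable_one_div_nat_pow.2 one_lt_two).mul_left C) ?_ ?_
    · intro d
      rcases eq_or_ne d 0 with rfl | hd
      · simp
      · have hd' : (0 : ℝ) < (d : ℝ) ^ 2 := by positivity
        have := ((tendsto_nonzeroCount hn ha hD).comp
          (tendsto_id.atTop_div_const hd')).const_mul ((moebius d : ℝ) / d ^ 2)
        refine this.congr' ?_
        filter_upwards [eventually_gt_atTop 0] with T hT
        simp only [Function.comp, id]
        field_simp
    · filter_upwards [eventually_gt_atTop 0] with T hT d
      have hμ : |(moebius d : ℝ)| ≤ 1 := by exact_mod_cast abs_moebius_le_one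
      have h1 := hC (T / d ^ 2) (by positivity)
      rw [norm_div, norm_mul, Real.norm_eq_abs, Real.norm_eq_abs, Real.norm_eq_abs, Nat.abs_cast,
        abs_of_pos hT, div_le_iff₀ hT]
      calc |(moebius d : ℝ)| * nonzeroCount (a, b, c) (T / d ^ 2)
          ≤ 1 * nonzeroCount (a, b, c) (T / d ^ 2) := by gcongr
        _ ≤ C * (T / d ^ 2) := by rw [one_mul]; exact h1
        _ = _ := by ring
  refine key.congr fun T => ?_
  rw [primitiveCount_eq_tsum hn ha hD, tsum_div_const]

end PositiveDefinite

section Action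

open Matrix

lemma det_eq (g : SpecialLinearGroup (Fin 2) ℤ) : g 0 0 * g 1 1 - g 0 1 * g 1 0 = 1 := by
  rw [← det_fin_two, g.det_coe]

lemma exists_sl {p q r s : ℤ} (h : p * s - q * r = 1) :
    ∃ g : SpecialLinearGroup (Fin 2) ℤ, g 0 0 = p ∧ g 0 1 = q ∧ g 1 0 = r ∧ g 1 1 = s :=
  ⟨⟨!![p, q; r, s], by rw [det_fin_two_of, h]⟩, rfl, rfl, rfl, rfl⟩

lemma sl_ext {g h : SpecialLinearGroup (Fin 2) ℤ} (h00 : g 0 0 = h 0 0) (h01 : g 0 1 = h 0 1)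
    (h10 : g 1 0 = h 1 0) (h11 : g 1 1 = h 1 1) : g = h := by
  ext i j
  fin_cases i <;> fin_cases j <;> assumption

lemma actForm_one (Q : ℤ × ℤ × ℤ) : actForm 1 Q = Q := by
  simp [actForm]

lemma actForm_mul (g h : SpecialLinearGroup (Fin 2) ℤ) (Q : ℤ × ℤ × ℤ) :
    actForm (g * h) Q = actForm h (actForm g Q) := by
  have hm : ∀ i j, (g * h) i j = g i 0 * h 0 j + g i 1 * h 1 j := fun i j => by
    change ((g : Matrix (Fin 2) (Fin 2) ℤ) * h) i j = _
    rw [mul_apply, Fin.sum_univ_two]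
  simp only [actForm, hm, Prod.mk.injEq]
  refine ⟨?_, ?_, ?_⟩ <;> ring

lemma actForm_eq_iff {g : SpecialLinearGroup (Fin 2) ℤ} {Q Q' : ℤ × ℤ × ℤ} :
    actForm g Q = Q' ↔ actForm g⁻¹ Q' = Q := by
  constructor <;> rintro rfl <;> simp [← actForm_mul, actForm_one]

lemma properEquiv_iff {Q Q' : ℤ × ℤ × ℤ} : ProperEquiv Q' Q ↔ ∃ g, actForm g Q = Q' :=
  ⟨fun ⟨g, h⟩ => ⟨g⁻¹, actForm_eq_iff.1 h⟩, fun ⟨g, h⟩ => ⟨g⁻¹, actForm_eq_iff.1 h⟩⟩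

lemma disc_actForm (g : SpecialLinearGroup (Fin 2) ℤ) (Q : ℤ × ℤ × ℤ) :
    (actForm g Q).2.1 ^ 2 - 4 * (actForm g Q).1 * (actForm g Q).2.2
      = Q.2.1 ^ 2 - 4 * Q.1 * Q.2.2 := by
  have h := det_eq g
  simp only [actForm]
  linear_combination (Q.2.1 ^ 2 - 4 * Q.1 * Q.2.2) * (g 0 0 * g 1 1 - g 0 1 * g 1 0 + 1) * h

lemma actForm_fst (g : SpecialLinearGroup (Fin 2) ℤ) (Q : ℤ × ℤ × ℤ) :
    (actForm g Q).1 = formVal Q (g 0 0, g 1 0) := rfl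

lemma gcd_col (g : SpecialLinearGroup (Fin 2) ℤ) : (g 0 0).gcd (g 1 0) = 1 := by
  rw [← Int.isCoprime_iff_gcd_eq_one]
  exact ⟨g 1 1, -g 0 1, by linear_combination det_eq g⟩

lemma actForm_neg (g : SpecialLinearGroup (Fin 2) ℤ) (Q : ℤ × ℤ × ℤ) :
    actForm g (-Q) = -actForm g Q := by
  simp only [actForm, Prod.neg_mk, Prod.fst_neg, Prod.snd_neg, Prod.mk.injEq]
  refine ⟨?_, ?_, ?_⟩ <;> ring

lemma ProperEquiv.neg_swap {A B C : ℤ} {Q : ℤ × ℤ × ℤ} (h : ProperEquiv (A, B, C) Q) :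
    ProperEquiv (-C, B, -A) (-Q) := by
  obtain ⟨g, hg⟩ := h
  obtain ⟨w, h00, h01, h10, h11⟩ := exists_sl (p := 0) (q := 1) (r := -1) (s := 0) (by norm_num)
  refine ⟨w * g, ?_⟩
  have : actForm w (-C, B, -A) = -(A, B, C) := by
    simp [actForm, h00, h01, h10, h11]
  rw [actForm_mul, this, actForm_neg, hg]

lemma DTQ_neg (n : ℤ) (Q : ℤ × ℤ × ℤ) (T : ℝ) : DTQ n (-Q) T = DTQ n Q T := by
  refine Set.ncard_congr (fun ac _ => (-ac.2, -ac.1)) ?_ ?_ ?_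
  · rintro ⟨A, C⟩ ⟨h1, h2, h3, h4, h5, b, hb, hb2, hQ⟩
    have := hQ.neg_swap
    rw [neg_neg] at this
    exact ⟨by simpa using h1, by simpa using h3, by simpa using h2, by simpa using h5,
      by simpa using h4, b, hb, by simpa [mul_comm] using hb2, this⟩
  · rintro ⟨A, C⟩ ⟨A', C'⟩ _ _ h
    simp_all
  · rintro ⟨A, C⟩ ⟨h1, h2, h3, h4, h5, b, hb, hb2, hQ⟩
    exact ⟨(-C, -A), ⟨by simpa using h1, by simpa using h3, by simpa using h2, by simpa using h5,
      by simpa using h4, b, hb, by simpa [mul_comm] using hb2, hQ.neg_swap⟩, by simp⟩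

/-- The substitutions taking `Q` to a form `[A, B, C]` with `0 ≤ B < 2A` and `A ≤ T`. -/
def normalizers (Q : ℤ × ℤ × ℤ) (T : ℝ) : Set (SpecialLinearGroup (Fin 2) ℤ) :=
  {g | 0 ≤ (actForm g Q).2.1 ∧ (actForm g Q).2.1 < 2 * (actForm g Q).1 ∧
    ((actForm g Q).1 : ℝ) ≤ T}

/-- The forms `[A, B, C]` equivalent to `Q` with `0 ≤ B < 2A` and `A ≤ T`. -/
def normalForms (Q : ℤ × ℤ × ℤ) (T : ℝ) : Set (ℤ × ℤ × ℤ) :=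
  {f | 0 ≤ f.2.1 ∧ f.2.1 < 2 * f.1 ∧ (f.1 : ℝ) ≤ T ∧ ProperEquiv f Q}

lemma normalizers_inj {Q : ℤ × ℤ × ℤ} {T : ℝ} {g h : SpecialLinearGroup (Fin 2) ℤ}
    (hg : g ∈ normalizers Q T) (hh : h ∈ normalizers Q T) (h0 : g 0 0 = h 0 0)
    (h1 : g 1 0 = h 1 0) : g = h := by
  have dg := det_eq g
  have dh := det_eq h
  rw [← h0, ← h1] at dh
  set m := (g 0 1 - h 0 1) * g 1 1 - (g 1 1 - h 1 1) * g 0 1 with hm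
  have hq : g 0 1 - h 0 1 = g 0 0 * m := by
    rw [hm]; linear_combination h 0 1 * dg - g 0 1 * dh
  have hs : g 1 1 - h 1 1 = g 1 0 * m := by
    rw [hm]; linear_combination h 1 1 * dg - g 1 1 * dh
  have hfst : (actForm h Q).1 = (actForm g Q).1 := by rw [actForm_fst, actForm_fst, h0, h1]
  have hb : (actForm g Q).2.1 - (actForm h Q).2.1 = 2 * (actForm g Q).1 * m := by
    simp only [actForm, ← h0, ← h1]
    linear_combination (2 * Q.1 * g 0 0 + Q.2.1 * g 1 0) * hq
      + (Q.2.1 * g 0 0 + 2 * Q.2.2 * g 1 0) * hs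
  have hA : 0 < 2 * (actForm g Q).1 := hg.1.trans_lt hg.2.1
  have hm0 : m = 0 := by
    have l1 := hg.2.1
    have l2 := hh.2.1
    have l3 := hg.1
    have l4 := hh.1
    rw [hfst] at l2
    have u1 : m < 1 := by
      by_contra! h'
      nlinarith
    have u2 : -1 < m := by
      by_contra! h'
      nlinarith
    omega
  rw [hm0, mul_zero, sub_eq_zero] at hq hs
  exact sl_ext h0 hq h1 hs

variable {n a b c : ℤ}

lemma actForm_fst_pos (hn : n < 0) (ha : 0 < a) (hD : b ^ 2 - 4 * a * c = 4 * n)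
    (g : SpecialLinearGroup (Fin 2) ℤ) : 0 < (actForm g (a, b, c)).1 := by
  rw [actForm_fst]
  refine formVal_pos hn ha hD fun h => ?_
  have := gcd_col g
  simp only [Prod.mk_eq_zero] at h
  simp [h.1, h.2] at this

lemma finite_normalizers (hn : n < 0) (ha : 0 < a) (hD : b ^ 2 - 4 * a * c = 4 * n) (T : ℝ) :
    (normalizers (a, b, c) T).Finite := by
  refine Set.Finite.of_finite_image (f := fun g => ((g 0 0, g 1 0) : ℤ × ℤ))
    ((finite_formVal_le hn ha hD T).subset ?_) ?_
  · rintro _ ⟨g, hg, rfl⟩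
    exact hg.2.2
  · intro g hg h hh he
    simp only [Prod.mk.injEq] at he
    exact normalizers_inj hg hh he.1 he.2

lemma ncard_normalizers (hn : n < 0) (ha : 0 < a) (hD : b ^ 2 - 4 * a * c = 4 * n) (T : ℝ) :
    (normalizers (a, b, c) T).ncard = primitiveCount (a, b, c) T := by
  refine Set.ncard_congr (fun g _ => (g 0 0, g 1 0)) ?_ ?_ ?_
  · exact fun g hg => ⟨gcd_col g, hg.2.2⟩
  · intro g h hg hh he
    simp only [Prod.mk.injEq] at he
    exact normalizers_inj hg hh he.1 he.2
  · rintro ⟨p, r⟩ ⟨hpr, hT⟩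
    obtain ⟨s, q, hsq⟩ := Int.isCoprime_iff_gcd_eq_one.2 hpr
    simp only at hsq
    set A := formVal (a, b, c) (p, r) with hA
    set B := 2 * a * p * (-q) + b * (p * s + (-q) * r) + 2 * c * r * s with hB
    set t := -(B / (2 * A)) with ht
    obtain ⟨g, h00, h01, h10, h11⟩ := exists_sl (p := p) (q := -q + p * t) (r := r)
      (s := s + r * t) (by linear_combination hsq)
    have e1 : (actForm g (a, b, c)).1 = A := by rw [actForm_fst, h00, h10]
    have hpos : 0 < A := e1 ▸ actForm_fst_pos hn ha hD g
    have e2 : (actForm g (a, b, c)).2.1 = B % (2 * A) := by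
      rw [Int.emod_def]
      simp only [actForm, h00, h01, h10, h11]
      rw [show B / (2 * A) = -t by rw [ht, neg_neg], hB, hA, formVal]
      ring
    refine ⟨g, ⟨?_, ?_, ?_⟩, by rw [h00, h10]⟩
    · rw [e2]; exact Int.emod_nonneg _ (by omega)
    · rw [e2, e1]; exact Int.emod_lt_of_pos _ (by omega)
    · rw [e1]; exact hT

lemma normalForms_eq_image (Q : ℤ × ℤ × ℤ) (T : ℝ) :
    normalForms Q T = (fun g => actForm g Q) '' normalizers Q T := by
  ext f
  constructor
  · rintro ⟨h1, h2, h3, h4⟩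
    obtain ⟨g, rfl⟩ := properEquiv_iff.1 h4
    exact ⟨g, ⟨h1, h2, h3⟩, rfl⟩
  · rintro ⟨g, ⟨h1, h2, h3⟩, rfl⟩
    exact ⟨h1, h2, h3, properEquiv_iff.2 ⟨g, rfl⟩⟩

lemma ncard_normalizers_eq_mul (hn : n < 0) (ha : 0 < a) (hD : b ^ 2 - 4 * a * c = 4 * n)
    (T : ℝ) : (normalizers (a, b, c) T).ncard =
      {g | actForm g (a, b, c) = (a, b, c)}.ncard * (normalForms (a, b, c) T).ncard := by
  classical
  have hfin := finite_normalizers hn ha hD T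
  have hmem : ∀ g, g ∈ hfin.toFinset ↔ g ∈ normalizers (a, b, c) T := by simp
  have hR : normalForms (a, b, c) T = (hfin.toFinset.image fun g => actForm g (a, b, c)) := by
    rw [normalForms_eq_image]; simp
  rw [hR, Set.ncard_coe_finset, Set.ncard_eq_toFinset_card _ hfin,
    Finset.card_eq_sum_card_image (fun g => actForm g (a, b, c)), mul_comm]
  refine Finset.sum_const_nat fun f hf => ?_
  obtain ⟨g₀, hg₀, rfl⟩ := Finset.mem_image.1 hf
  rw [hmem] at hg₀
  rw [← Set.ncard_coe_finset]
  refine Set.ncard_congr (fun g _ => g * g₀⁻¹) ?_ ?_ ?_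
  · intro g hg
    simp only [Finset.coe_filter, Set.mem_ofPred_eq] at hg
    change actForm _ _ = _
    rw [actForm_mul, hg.2, ← actForm_mul, mul_inv_cancel, actForm_one]
  · intro g h _ _ he
    exact mul_right_cancel he
  · intro h hh
    have e : actForm (h * g₀) (a, b, c) = actForm g₀ (a, b, c) := by
      rw [actForm_mul, show actForm h (a, b, c) = (a, b, c) from hh]
    refine ⟨h * g₀, ?_, by simp⟩
    simp only [Finset.coe_filter, Set.mem_ofPred_eq, hmem]
    refine ⟨?_, e⟩
    simp only [normalizers, Set.mem_ofPred_eq, e]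
    exact hg₀

lemma finite_normalForms (hn : n < 0) (ha : 0 < a) (hD : b ^ 2 - 4 * a * c = 4 * n) (T : ℝ) :
    (normalForms (a, b, c) T).Finite := by
  rw [normalForms_eq_image]
  exact (finite_normalizers hn ha hD T).image _

lemma ProperEquiv.disc_eq {f : ℤ × ℤ × ℤ} (hD : b ^ 2 - 4 * a * c = 4 * n)
    (h : ProperEquiv f (a, b, c)) : f.2.1 ^ 2 - 4 * f.1 * f.2.2 = 4 * n := by
  obtain ⟨g, rfl⟩ := properEquiv_iff.1 h
  rw [disc_actForm, hD]

lemma ProperEquiv.fst_pos {f : ℤ × ℤ × ℤ} (hn : n < 0) (ha : 0 < a)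
    (hD : b ^ 2 - 4 * a * c = 4 * n) (h : ProperEquiv f (a, b, c)) : 0 < f.1 := by
  obtain ⟨g, rfl⟩ := properEquiv_iff.1 h
  exact actForm_fst_pos hn ha hD g

lemma DTQ_eq_ncard_forms (hn : n < 0) (ha : 0 < a) (hD : b ^ 2 - 4 * a * c = 4 * n) (T : ℝ) :
    DTQ n (a, b, c) T = {f ∈ normalForms (a, b, c) T | f.2.2 < f.1}.ncard := by
  symm
  refine Set.ncard_congr (fun f _ => (f.1, f.2.2)) ?_ ?_ ?_
  · rintro ⟨A, B, C⟩ ⟨⟨h1, h2, h3, h4⟩, h5⟩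
    have hA := h4.fst_pos hn ha hD
    have hd := h4.disc_eq hD
    simp only at h1 h2 h3 h5 hA hd
    have hC : 0 < C := pos_of_disc hn hA hd
    obtain ⟨m, rfl⟩ : 2 ∣ B := Int.prime_two.dvd_of_dvd_pow (n := 2)
      ⟨2 * (n + A * C), by linarith⟩
    have hC' : (0 : ℝ) < C := by exact_mod_cast hC
    have hA' : (0 : ℝ) < A := by exact_mod_cast hA
    have h5' : (C : ℝ) < A := by exact_mod_cast h5
    refine ⟨h5, hA.ne', hC.ne', ?_, ?_, m, by omega, by linarith, h4⟩
    · rwa [abs_of_pos hA']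
    · simp only; rw [abs_of_pos hC']; linarith
  · rintro ⟨A, B, C⟩ ⟨A', B', C'⟩ ⟨h, -⟩ ⟨h', -⟩ he
    simp only [Prod.mk.injEq] at he
    obtain ⟨rfl, rfl⟩ := he
    have e1 := h.2.2.2.disc_eq hD
    have e2 := h'.2.2.2.disc_eq hD
    have l1 := h.1
    have l2 := h'.1
    simp only at e1 e2 l1 l2
    have : B = B' := (sq_eq_sq₀ l1 l2).1 (by linarith)
    rw [this]
  · rintro ⟨A, C⟩ ⟨h1, h2, h3, h4, h5, m, hm, hm2, hQ⟩
    refine ⟨(A, 2 * m, C), ⟨⟨by simpa using hm, ?_, (le_abs_self _).trans h4, hQ⟩, h1⟩, rfl⟩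
    have hA := hQ.fst_pos hn ha hD
    simp only at hA h1 hm2 ⊢
    by_contra! h
    nlinarith

lemma DTQ_bounds (hn : n < 0) (ha : 0 < a) (hD : b ^ 2 - 4 * a * c = 4 * n) (T : ℝ) :
    DTQ n (a, b, c) T ≤ (normalForms (a, b, c) T).ncard ∧
    (normalForms (a, b, c) T).ncard ≤ DTQ n (a, b, c) T + (normalForms (a, b, c) (-n)).ncard := by
  have hfin := finite_normalForms hn ha hD
  rw [DTQ_eq_ncard_forms hn ha hD]
  refine ⟨Set.ncard_le_ncard (Set.sep_subset _ _) (hfin T), ?_⟩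
  refine (Set.ncard_le_ncard ?_ (((hfin T).subset (Set.sep_subset _ _)).union (hfin _))).trans
    (Set.ncard_union_le _ _)
  intro f hf
  by_cases h : f.2.2 < f.1
  · exact Or.inl ⟨hf, h⟩
  · refine Or.inr ⟨hf.1, hf.2.1, ?_, hf.2.2.2⟩
    have hA := hf.2.2.2.fst_pos hn ha hD
    have hd := hf.2.2.2.disc_eq hD
    have l1 := hf.1
    have l2 := hf.2.1
    push Not at h
    have : f.1 ≤ -n := by nlinarith
    exact_mod_cast this

end Action

section Automorphs

open Matrix

lemma ncard_pell_solutions {d : ℤ} (hd : d < 0) (hmod : d % 4 = 0 ∨ d % 4 = 1) :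
    {w : ℤ × ℤ | w.1 ^ 2 - d * w.2 ^ 2 = 4}.ncard = omegaDisc d := by
  have bound : ∀ t u : ℤ, t ^ 2 - d * u ^ 2 = 4 → (-2 ≤ t ∧ t ≤ 2) ∧ (-1 ≤ u ∧ u ≤ 1) := by
    intro t u h
    have hd3 : d ≤ -3 := by omega
    have ht : t ^ 2 ≤ 2 ^ 2 := by nlinarith [sq_nonneg u]
    have hu : u ^ 2 ≤ 1 ^ 2 := by nlinarith [sq_nonneg t, sq_nonneg u]
    exact ⟨abs_le_of_sq_le_sq' ht (by norm_num), abs_le_of_sq_le_sq' hu (by norm_num)⟩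
  have of_finset : ∀ s : Finset (ℤ × ℤ), (∀ t u : ℤ, (t, u) ∈ s ↔ t ^ 2 - d * u ^ 2 = 4) →
      {w : ℤ × ℤ | w.1 ^ 2 - d * w.2 ^ 2 = 4}.ncard = s.card := fun s hs => by
    rw [← Set.ncard_coe_finset]
    congr 1
    ext ⟨t, u⟩
    exact (hs t u).symm
  rcases (by omega : d = -4 ∨ d = -3 ∨ d ≤ -7) with rfl | rfl | hd7
  · rw [of_finset {(2, 0), (-2, 0), (0, 1), (0, -1)}]
    · rfl
    · intro t u
      constructor
      · intro h
        simp only [Finset.mem_insert, Finset.mem_singleton, Prod.mk.injEq] at h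
        rcases h with ⟨rfl, rfl⟩ | ⟨rfl, rfl⟩ | ⟨rfl, rfl⟩ | ⟨rfl, rfl⟩ <;> norm_num
      · intro h
        obtain ⟨⟨h1, h2⟩, h3, h4⟩ := bound t u h
        interval_cases t <;> interval_cases u <;> simp_all
  · rw [of_finset {(2, 0), (-2, 0), (1, 1), (1, -1), (-1, 1), (-1, -1)}]
    · rfl
    · intro t u
      constructor
      · intro h
        simp only [Finset.mem_insert, Finset.mem_singleton, Prod.mk.injEq] at h
        rcases h with ⟨rfl, rfl⟩ | ⟨rfl, rfl⟩ | ⟨rfl, rfl⟩ | ⟨rfl, rfl⟩ | ⟨rfl, rfl⟩ | ⟨rfl, rfl⟩ <;>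
          norm_num
      · intro h
        obtain ⟨⟨h1, h2⟩, h3, h4⟩ := bound t u h
        interval_cases t <;> interval_cases u <;> simp_all
  · rw [of_finset {(2, 0), (-2, 0)}, omegaDisc, if_neg (by omega), if_neg (by omega)]
    · rfl
    · intro t u
      constructor
      · intro h
        simp only [Finset.mem_insert, Finset.mem_singleton, Prod.mk.injEq] at h
        rcases h with ⟨rfl, rfl⟩ | ⟨rfl, rfl⟩ <;> norm_num
      · intro h
        have hu : u = 0 := by
          by_contra hu
          have : 0 < u ^ 2 := by positivity
          nlinarith [sq_nonneg t]
        subst hu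
        have : (t - 2) * (t + 2) = 0 := by linear_combination h
        rcases mul_eq_zero.1 this with h' | h'
        · simp [show t = 2 by linarith]
        · simp [show t = -2 by linarith]

/-- The automorphs of a primitive form of discriminant `d` correspond to the solutions of
`t² - d u² = 4`. -/
lemma ncard_automorphs_eq_pell {a b c x y z d : ℤ} (hx : x * a + y * b + z * c = 1)
    (hd : b ^ 2 - 4 * a * c = d) :
    {g | actForm g (a, b, c) = (a, b, c)}.ncard = {w : ℤ × ℤ | w.1 ^ 2 - d * w.2 ^ 2 = 4}.ncard := by
  have key : ∀ g : SpecialLinearGroup (Fin 2) ℤ, actForm g (a, b, c) = (a, b, c) →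
      g 1 0 = a * (x * g 1 0 + y * (g 1 1 - g 0 0) - z * g 0 1) ∧
      g 1 1 - g 0 0 = b * (x * g 1 0 + y * (g 1 1 - g 0 0) - z * g 0 1) ∧
      -g 0 1 = c * (x * g 1 0 + y * (g 1 1 - g 0 0) - z * g 0 1) := by
    intro g hg
    have dg := det_eq g
    simp only [actForm, Prod.mk.injEq] at hg
    obtain ⟨h1, h2, h3⟩ := hg
    generalize g 0 0 = p at *
    generalize g 0 1 = q at *
    generalize g 1 0 = r at *
    generalize g 1 1 = s at *
    have e1 : a * (s - p) = b * r := by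
      have : 2 * (a * (s - p)) = 2 * (b * r) := by
        linear_combination (2 * a * p + b * r) * dg - 2 * s * h1 + r * h2
      linarith
    have e2 : a * q = -(c * r) := by
      have : 2 * (a * q) = 2 * -(c * r) := by
        linear_combination (-(2 * a * q + b * s)) * dg + s * h2 - 2 * r * h3
      linarith
    have e3 : c * (s - p) = -(b * q) := by
      have : 2 * (c * (s - p)) = 2 * -(b * q) := by
        linear_combination (-(2 * c * s + b * q)) * dg + 2 * p * h3 - q * h2
      linarith
    refine ⟨?_, ?_, ?_⟩
    · linear_combination (-r) * hx - y * e1 + z * e2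
    · linear_combination (-(s - p)) * hx + x * e1 + z * e3
    · linear_combination q * hx - x * e2 - y * e3
  refine Set.ncard_congr
    (fun g _ => (g 0 0 + g 1 1, x * g 1 0 + y * (g 1 1 - g 0 0) - z * g 0 1)) ?_ ?_ ?_
  · intro g hg
    obtain ⟨k1, k2, k3⟩ := key g hg
    have dg := det_eq g
    simp only [Set.mem_ofPred_eq]
    generalize x * g 1 0 + y * (g 1 1 - g 0 0) - z * g 0 1 = u at *
    rw [← hd]
    have k12 : a * c * u ^ 2 = -(g 1 0 * g 0 1) := by
      linear_combination (-(c * u)) * k1 - g 1 0 * k3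
    linear_combination 4 * dg + 4 * k12 + (g 1 1 - g 0 0 + b * u) * k2
  · intro g h hg hh he
    obtain ⟨k1, k2, k3⟩ := key g hg
    obtain ⟨l1, l2, l3⟩ := key h hh
    simp only [Prod.mk.injEq] at he
    obtain ⟨he1, he2⟩ := he
    rw [he2] at k1 k2 k3
    exact sl_ext (by linarith) (by linarith) (by linarith) (by linarith)
  · rintro ⟨t, u⟩ htu
    simp only [Set.mem_ofPred_eq] at htu
    obtain ⟨m, hm⟩ : 2 ∣ t - b * u := by
      have h2 : 2 ∣ (t - b * u) ^ 2 :=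
        ⟨2 - 2 * a * c * u ^ 2 - b * u * (t - b * u), by
          linear_combination htu - u ^ 2 * hd⟩
      exact Int.prime_two.dvd_of_dvd_pow h2
    obtain rfl : t = 2 * m + b * u := by linarith
    obtain ⟨g, h00, h01, h10, h11⟩ := exists_sl (p := m) (q := -(c * u)) (r := a * u)
      (s := m + b * u) (by
        have : 4 * (m * (m + b * u) - -(c * u) * (a * u)) = 4 * 1 := by
          linear_combination htu - u ^ 2 * hd
        linarith)
    have dg := det_eq g
    rw [h00, h01, h10, h11] at dg
    refine ⟨g, ?_, ?_⟩
    · simp only [Set.mem_ofPred_eq, actForm, h00, h01, h10, h11, Prod.mk.injEq]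
      refine ⟨?_, ?_, ?_⟩
      · linear_combination a * dg
      · linear_combination b * dg
      · linear_combination c * dg
    · simp only [h00, h01, h10, h11, Prod.mk.injEq]
      exact ⟨by ring, by linear_combination u * hx⟩

lemma actForm_smul (g : SpecialLinearGroup (Fin 2) ℤ) (k a b c : ℤ) :
    actForm g (k * a, k * b, k * c) = (k * (actForm g (a, b, c)).1,
      k * (actForm g (a, b, c)).2.1, k * (actForm g (a, b, c)).2.2) := by
  simp only [actForm, Prod.mk.injEq]
  refine ⟨?_, ?_, ?_⟩ <;> ring

lemma ncard_automorphs {n a b c d : ℤ} {k : ℕ} (hn : n < 0) (hD : b ^ 2 - 4 * a * c = 4 * n)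
    (hk : Int.gcd a (Int.gcd b c) = k) (hd : 4 * n = d * (k : ℤ) ^ 2) :
    {g | actForm g (a, b, c) = (a, b, c)}.ncard = omegaDisc d := by
  have hk0 : (k : ℤ) ≠ 0 := by
    intro h
    rw [h] at hd
    norm_num at hd
    omega
  have ka : (k : ℤ) ∣ a := hk ▸ Int.gcd_dvd_left _ _
  have kbc : (k : ℤ) ∣ Int.gcd b c := hk ▸ Int.gcd_dvd_right _ _
  have bez : ∃ x y z : ℤ, x * a + y * b + z * c = k := by
    refine ⟨Int.gcdA a (Int.gcd b c), Int.gcdB a (Int.gcd b c) * Int.gcdA b c,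
      Int.gcdB a (Int.gcd b c) * Int.gcdB b c, ?_⟩
    rw [← hk, Int.gcd_eq_gcd_ab a, Int.gcd_eq_gcd_ab b c]
    ring
  obtain ⟨x, y, z, hxyz⟩ := bez
  obtain ⟨a, rfl⟩ := ka
  obtain ⟨b, rfl⟩ := kbc.trans (Int.gcd_dvd_left b c)
  obtain ⟨c, rfl⟩ := kbc.trans (Int.gcd_dvd_right _ c)
  have hx : x * a + y * b + z * c = 1 :=
    mul_left_cancel₀ hk0 (by linear_combination hxyz)
  have hdd : b ^ 2 - 4 * a * c = d :=
    mul_left_cancel₀ (pow_ne_zero 2 hk0) (by linear_combination hD + hd)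
  have hneg : d < 0 := by
    have : 0 < (k : ℤ) ^ 2 := by positivity
    by_contra! h
    nlinarith
  have hset : {g | actForm g ((k : ℤ) * a, (k : ℤ) * b, (k : ℤ) * c) = (k * a, k * b, k * c)}
      = {g | actForm g (a, b, c) = (a, b, c)} := by
    ext g
    simp only [Set.mem_ofPred_eq, actForm_smul, Prod.ext_iff, mul_right_inj' hk0]
  rw [hset, ncard_automorphs_eq_pell hx hdd, ncard_pell_solutions hneg]
  have : b ^ 2 % 4 = 0 ∨ b ^ 2 % 4 = 1 := by
    rcases Int.even_or_odd' b with ⟨m, rfl | rfl⟩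
    · left; ring_nf; omega
    · right; ring_nf; omega
  rw [← hdd, mul_assoc]
  omega

end Automorphs

lemma DTQ_sub_isLittleO_of_pos {n a b c d : ℤ} {k : ℕ} (hn : n < 0) (ha : 0 < a)
    (hD : b ^ 2 - 4 * a * c = 4 * n) (hk : Int.gcd a (Int.gcd b c) = k)
    (hd : 4 * n = d * (k : ℤ) ^ 2) :
    (fun T : ℝ => (DTQ n (a, b, c) T : ℝ) -
        6 * T / ((omegaDisc d : ℝ) * Real.pi * Real.sqrt |(n : ℝ)|))
      =o[atTop] (fun T : ℝ => T) := by
  have hw : 0 < omegaDisc d := by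
    unfold omegaDisc; split_ifs <;> norm_num
  have hw' : (0 : ℝ) < omegaDisc d := by exact_mod_cast hw
  have hcount : ∀ T : ℝ, ((normalForms (a, b, c) T).ncard : ℝ)
      = primitiveCount (a, b, c) T / omegaDisc d := fun T => by
    rw [← ncard_normalizers hn ha hD, ncard_normalizers_eq_mul hn ha hD,
      ncard_automorphs hn hD hk hd, Nat.cast_mul, mul_div_cancel_left₀ _ hw'.ne']
  have hlim : Tendsto (fun T : ℝ => ((normalForms (a, b, c) T).ncard : ℝ) / T) atTop
      (nhds (6 / (omegaDisc d * π * √|(n : ℝ)|))) := by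
    have := (tendsto_primitiveCount hn ha hD).div_const (omegaDisc d : ℝ)
    rw [div_div, show π * √|(n : ℝ)| * omegaDisc d = omegaDisc d * π * √|(n : ℝ)| by ring] at this
    refine this.congr fun T => ?_
    rw [hcount]
    ring
  set K := (normalForms (a, b, c) (-n)).ncard with hK
  have hlim' : Tendsto (fun T : ℝ => (DTQ n (a, b, c) T : ℝ) / T) atTop
      (nhds (6 / (omegaDisc d * π * √|(n : ℝ)|))) := by
    have hlow := hlim.sub (tendsto_inv_atTop_zero.const_mul (K : ℝ))
    rw [mul_zero, sub_zero] at hlow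
    refine tendsto_of_tendsto_of_tendsto_of_le_of_le' hlow hlim ?_ ?_
    · filter_upwards [eventually_gt_atTop 0] with T hT
      have : ((normalForms (a, b, c) T).ncard : ℝ) ≤ DTQ n (a, b, c) T + K := by
        rw [hK]; exact_mod_cast (DTQ_bounds hn ha hD T).2
      rw [← div_eq_mul_inv, ← sub_div]
      gcongr
      linarith
    · filter_upwards [eventually_gt_atTop 0] with T hT
      have := (DTQ_bounds hn ha hD T).1
      gcongr
  refine (isLittleO_iff_tendsto' ?_).2 ?_
  · filter_upwards [eventually_gt_atTop 0] with T hT h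
    exact absurd h hT.ne'
  · have := hlim'.sub_const (6 / (omegaDisc d * π * √|(n : ℝ)|))
    rw [sub_self] at this
    refine this.congr' ?_
    filter_upwards [eventually_gt_atTop 0] with T hT
    field_simp

/-- **Theorem 1 (a).** For a negative integer `n` and an integral binary quadratic form
`Q = [a,b,c]` of discriminant `4n` and content `k` (so `d' = 4n/k²` is the discriminant
of the primitive form `Q/k`), as `T → ∞` one has
`D_T^Q = 6T / (ω(d') π |n|^{1/2}) + o(T)`. -/
theorem equidistribution_definite (n : ℤ) (hn : n < 0) (a b c : ℤ) (k : ℕ) (d' : ℤ)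
    (hdisc : b ^ 2 - 4 * a * c = 4 * n)
    (hcontent : Int.gcd a (Int.gcd b c) = k)
    (hd' : 4 * n = d' * (k : ℤ) ^ 2) :
    (fun T : ℝ => (DTQ n (a, b, c) T : ℝ) -
        6 * T / ((omegaDisc d' : ℝ) * Real.pi * Real.sqrt |(n : ℝ)|))
      =o[atTop] (fun T : ℝ => T) := by
  rcases lt_trichotomy a 0 with ha | rfl | ha
  · have h := DTQ_sub_isLittleO_of_pos (a := -a) (b := -b) (c := -c) hn (by omega) (by linarith)
      (by simpa using hcontent) hd'
    have e : ∀ T : ℝ, DTQ n (-a, -b, -c) T = DTQ n (a, b, c) T := DTQ_neg n (a, b, c)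
    simpa only [e] using h
  · nlinarith [sq_nonneg b]
  · exact DTQ_sub_isLittleO_of_pos hn ha hdisc hcontent hd'
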